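/- arXiv:2405.02513 — 2 statements merged into one kernel-verified Lean document; each statement's English description precedes it below -/
import Mathlib

section
/- Let J₀ : ℝ⁴ → ℝ⁴ be the standard complex structure, i.e. the linear map with J₀e₁ = e₂, J₀e₂ = −e₁, J₀e₃ = e₄, J₀e₄ = −e₃ on the standard basis. Let A be a real 4×4 orthogonal matrix (AᵀA = I) with columns v₁, v₂, v₃, v₄. If the 2-plane spanned by v₂ and v₃ is invariant under J₀ (i.e. J₀v₂ and J₀v₃ both lie in the real span of v₂ and v₃), then A does not commute with J₀: A·J₀ ≠ J₀·A. -/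
open Matrix

/-- If `A` is a real orthogonal 4×4 matrix whose columns are `v 0, v 1, v 2, v 3`,
`J₀` is the standard complex structure on `ℝ⁴`, and the 2-plane spanned by the
columns `v 1` and `v 2` is invariant under `J₀`, then `A` does not commute with `J₀`. -/
theorem stmt_0 (A : Matrix (Fin 4) (Fin 4) ℝ)
    (hA : Aᵀ * A = 1)
    (J₀ : Matrix (Fin 4) (Fin 4) ℝ)
    (hJ : J₀ = !![0, -1, 0, 0; 1, 0, 0, 0; 0, 0, 0, -1; 0, 0, 1, 0])
    (v : Fin 4 → Fin 4 → ℝ)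
    (hv : ∀ i k, v i k = A k i)
    (h₂ : J₀.mulVec (v 1) ∈ Submodule.span ℝ ({v 1, v 2} : Set (Fin 4 → ℝ)))
    (h₃ : J₀.mulVec (v 2) ∈ Submodule.span ℝ ({v 1, v 2} : Set (Fin 4 → ℝ))) :
    A * J₀ ≠ J₀ * A := by
  intro hcomm
  have hcol : ∀ i, v i = A.col i := fun i => funext (hv i)
  have hdot : ∀ i j, v i ⬝ᵥ v j = (1 : Matrix (Fin 4) (Fin 4) ℝ) i j := fun i j => by
    rw [← hA, hcol, hcol]
    rfl
  have hJv : J₀ *ᵥ v 1 = -v 0 := by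
    have hJ1 : J₀ *ᵥ Pi.single 1 1 = -Pi.single 0 1 := by
      ext i
      fin_cases i <;> simp [hJ]
    rw [hcol, hcol, ← mulVec_single_one, mulVec_mulVec, ← hcomm, ← mulVec_mulVec, hJ1,
      mulVec_neg, mulVec_single_one]
  obtain ⟨a, b, hab⟩ := Submodule.mem_span_pair.1 h₂
  have h := congrArg (v 0 ⬝ᵥ ·) (hab.trans hJv)
  simp [hdot] at h
end

section
/- For every integer n ≥ 2 and all (s, t), (s', t') ∈ ℂ², the parametrization Φ of the A_{n−1} singularity satisfies Φ(s, t) = Φ(s', t') if and only if there exists ζ ∈ ℂ with ζⁿ = 1 such that s' = ζ·s and t' = ζ⁻¹·t. Consequently, the fibers of Φ are exactly the orbits of the cyclic group of order n acting on ℂ² by (s, t) ↦ (ζs, ζ⁻¹t) for n-th roots of unity ζ. -/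
/-- In a field, two pairs with equal `n`-th powers and equal products differ by the action of an
`n`-th root of unity. -/
theorem exists_pow_eq_one_of_pow_eq_of_mul_eq {K : Type*} [Field K] {n : ℕ} (hn : n ≠ 0)
    {s t s' t' : K} (hs : s ^ n = s' ^ n) (ht : t ^ n = t' ^ n) (hst : s * t = s' * t') :
    ∃ ζ : K, ζ ^ n = 1 ∧ s' = ζ * s ∧ t' = ζ⁻¹ * t := by
  have eq_zero_iff {a b : K} (h : a ^ n = b ^ n) : a = 0 ↔ b = 0 := by
    rw [← pow_eq_zero_iff hn, h, pow_eq_zero_iff hn]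
  by_cases hs0 : s = 0
  · have hs0' : s' = 0 := (eq_zero_iff hs).1 hs0
    by_cases ht0 : t = 0
    · have ht0' : t' = 0 := (eq_zero_iff ht).1 ht0
      exact ⟨1, one_pow n, by simp [hs0, hs0'], by simp [ht0, ht0']⟩
    · have ht0' : t' ≠ 0 := fun h => ht0 ((eq_zero_iff ht).2 h)
      refine ⟨t / t', ?_, by simp [hs0, hs0'], ?_⟩
      · rw [div_pow, ht, div_self (pow_ne_zero n ht0')]
      · rw [inv_div, div_mul_cancel₀ _ ht0]
  · have hs0' : s' ≠ 0 := fun h => hs0 ((eq_zero_iff hs).2 h)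
    refine ⟨s' / s, ?_, (div_mul_cancel₀ _ hs0).symm, ?_⟩
    · rw [div_pow, ← hs, div_self (pow_ne_zero n hs0)]
    · rw [inv_div, div_mul_eq_mul_div, hst, mul_div_cancel_left₀ _ hs0']


/-- For every integer `n ≥ 2`, the parametrization
`Φ(s, t) = (½(sⁿ - tⁿ), (√-1/2)(sⁿ + tⁿ), st)` of the `A_{n-1}` singularity satisfies
`Φ(s, t) = Φ(s', t')` if and only if there is an `n`-th root of unity `ζ` with
`s' = ζs` and `t' = ζ⁻¹t`: the fibers of `Φ` are exactly the orbits of the cyclic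
group of order `n` acting on `ℂ²` by `(s, t) ↦ (ζs, ζ⁻¹t)`. -/
theorem stmt_10 (n : ℕ) (hn : 2 ≤ n)
    (Φ : ℂ × ℂ → ℂ × ℂ × ℂ)
    (hΦ : ∀ s t : ℂ, Φ (s, t) =
      ((s ^ n - t ^ n) / 2, Complex.I / 2 * (s ^ n + t ^ n), s * t))
    (s t s' t' : ℂ) :
    Φ (s, t) = Φ (s', t') ↔ ∃ ζ : ℂ, ζ ^ n = 1 ∧ s' = ζ * s ∧ t' = ζ⁻¹ * t := by
  rw [hΦ, hΦ, Prod.mk.injEq, Prod.mk.injEq]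
  constructor
  · rintro ⟨hsub, hadd, hmul⟩
    have hI : Complex.I / 2 ≠ 0 := div_ne_zero Complex.I_ne_zero two_ne_zero
    have hadd' := mul_left_cancel₀ hI hadd
    exact exists_pow_eq_one_of_pow_eq_of_mul_eq (by omega)
      (by linear_combination hsub + hadd' / 2) (by linear_combination hadd' / 2 - hsub) hmul
  · rintro ⟨ζ, hζ, rfl, rfl⟩
    have hζ0 : ζ ≠ 0 := by
      rintro rfl
      simp [zero_pow (by omega : n ≠ 0)] at hζ
    refine ⟨by simp [mul_pow, hζ], by simp [mul_pow, hζ], ?_⟩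
    field_simp
end
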